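/- Let a ≥ 0, N ≥ 3 and 1 < p < (N+2+2a)/(N−2). Let u be a positive C² solution of −Δu = |x|^a u^p on ℝ^N that is stable outside a compact set Σ ⊂ ℝ^N. Then ∇u ∈ L²(ℝ^N) and |x|^a u^{p+1} ∈ L¹(ℝ^N), i.e. ∫_{ℝ^N} |∇u|² < ∞ and ∫_{ℝ^N} |x|^a u^{p+1} < ∞. -/

import Mathlib

open MeasureTheory Real Metric

/-- The Laplacian of a function on Euclidean space, as the sum of its second
partial derivatives in the coordinate directions. -/
noncomputable def lap {N : ℕ} (f : EuclideanSpace ℝ (Fin N) → ℝ)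
    (x : EuclideanSpace ℝ (Fin N)) : ℝ :=
  ∑ i : Fin N,
    fderiv ℝ (fun y => fderiv ℝ f y (EuclideanSpace.single i 1)) x (EuclideanSpace.single i 1)

lemma hcs_congr {X : Type*} [TopologicalSpace X] {f g : X → ℝ} (hg : HasCompactSupport g)
    (h : ∀ x, f x = g x) : HasCompactSupport f := by
  have : f = g := funext h
  rwa [this]

lemma norm_gradient_eq {N : ℕ} (f : EuclideanSpace ℝ (Fin N) → ℝ)
    (x : EuclideanSpace ℝ (Fin N)) : ‖gradient f x‖ = ‖fderiv ℝ f x‖ := by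
  simp [gradient]

lemma norm_fderiv_sq {N : ℕ} (f : EuclideanSpace ℝ (Fin N) → ℝ)
    (x : EuclideanSpace ℝ (Fin N)) :
    ‖fderiv ℝ f x‖ ^ 2 = ∑ i, (fderiv ℝ f x (EuclideanSpace.single i 1)) ^ 2 := by
  rw [← norm_gradient_eq, EuclideanSpace.norm_sq_eq]
  refine Finset.sum_congr rfl fun i _ => ?_
  have : fderiv ℝ f x (EuclideanSpace.single i 1) = (gradient f x) i := by
    have h : fderiv ℝ f x (EuclideanSpace.single i 1)
        = inner ℝ (gradient f x) (EuclideanSpace.single i 1) := by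
      simp [gradient]
    rw [h, EuclideanSpace.inner_single_right]
    simp
  rw [this]; simp

lemma young_pt (p w v t g ε : ℝ) (m : ℕ) (hp : 1 < p) (hw : 0 < w) (hv : 0 < v)
    (ht0 : 0 ≤ t) (ht1 : t ≤ 1) (hg : 0 ≤ g) (hε : 0 < ε) (hm : 2 / (p - 1) ≤ m) :
    v ^ 2 * (((m : ℝ) + 1) * t ^ m) ^ 2 * g ≤ ε * (w * v ^ (p + 1) * (t ^ (m + 1)) ^ 2)
      + (((m : ℝ) + 1) ^ 2 * g / (ε * w)) ^ (2 / (p - 1)) * (((m : ℝ) + 1) ^ 2 * g) := by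
  have hq : 0 < 2 / (p - 1) := div_pos two_pos (by linarith)
  set q := 2 / (p - 1) with hqd
  have hm0 : m ≠ 0 := by
    rintro rfl
    simp at hm; linarith
  set L := ((m : ℝ) + 1) ^ 2 * g with hL
  have hL0 : 0 ≤ L := by positivity
  have hA : 0 ≤ (L / (ε * w)) ^ q * L := by positivity
  have hB : 0 ≤ ε * (w * v ^ (p + 1) * (t ^ (m + 1)) ^ 2) := by positivity
  rcases ht0.eq_or_lt with rfl | ht
  · rw [zero_pow hm0]; simp only [mul_zero]; nlinarith
  have hvp : v ^ (p + 1) = v ^ (p - 1) * v ^ 2 := by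
    rw [← Real.rpow_natCast v 2, ← Real.rpow_add hv]; congr 1; push_cast; ring
  by_cases hc : L ≤ ε * w * v ^ (p - 1) * t ^ 2
  · have : v ^ 2 * (t ^ m) ^ 2 * L ≤ v ^ 2 * (t ^ m) ^ 2 * (ε * w * v ^ (p - 1) * t ^ 2) := by
      gcongr
    have e1 : v ^ 2 * (((m : ℝ) + 1) * t ^ m) ^ 2 * g = v ^ 2 * (t ^ m) ^ 2 * L := by
      rw [hL]; ring
    have e2 : ε * (w * v ^ (p + 1) * (t ^ (m + 1)) ^ 2)
      = v ^ 2 * (t ^ m) ^ 2 * (ε * w * v ^ (p - 1) * t ^ 2) := by rw [hvp]; ring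
    linarith
  · push Not at hc
    have h1 : v ^ (p - 1) * t ^ 2 ≤ L / (ε * w) := by
      rw [le_div_iff₀ (by positivity)]; linarith
    have h2 : (v ^ (p - 1) * t ^ 2) ^ q ≤ (L / (ε * w)) ^ q :=
      Real.rpow_le_rpow (by positivity) h1 hq.le
    have h3 : (v ^ (p - 1) * t ^ 2) ^ q = v ^ 2 * (t ^ q) ^ 2 := by
      rw [Real.mul_rpow (by positivity) (by positivity), ← Real.rpow_mul hv.le]
      congr 1
      · rw [show (p - 1) * q = 2 by rw [hqd]; field_simp [show p - 1 ≠ 0 by linarith]]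
        norm_cast
      · rw [← Real.rpow_natCast, ← Real.rpow_natCast, ← Real.rpow_mul ht.le,
          ← Real.rpow_mul ht.le, mul_comm]
    have h4 : t ^ m ≤ t ^ q := by
      rw [← Real.rpow_natCast]
      exact Real.rpow_le_rpow_of_exponent_ge ht ht1 hm
    have h5 : v ^ 2 * (t ^ m) ^ 2 ≤ (L / (ε * w)) ^ q := by
      refine le_trans ?_ h2
      rw [h3]; gcongr
    have e1 : v ^ 2 * (((m : ℝ) + 1) * t ^ m) ^ 2 * g = v ^ 2 * (t ^ m) ^ 2 * L := by
      rw [hL]; ring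
    have := mul_le_mul_of_nonneg_right h5 hL0
    linarith

/-- energy identity -/
lemma energy {N : ℕ} (u η : EuclideanSpace ℝ (Fin N) → ℝ)
    (hu : ContDiff ℝ 2 u) (hη : ContDiff ℝ 1 η) (hc : HasCompactSupport η) :
    ∫ x, ‖fderiv ℝ (fun y => u y * η y) x‖ ^ 2
      = (∫ x, (-lap u x) * (u x * η x ^ 2)) + ∫ x, u x ^ 2 * ‖fderiv ℝ η x‖ ^ 2 := by
  have hu1 : ContDiff ℝ 1 u := hu.of_le (by norm_num)
  have hud : Differentiable ℝ u := hu1.differentiable (by norm_num)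
  have hηd : Differentiable ℝ η := hη.differentiable (by norm_num)
  let e : Fin N → EuclideanSpace ℝ (Fin N) := fun i => EuclideanSpace.single i 1
  have hD : ∀ i, ContDiff ℝ 1 (fun y => fderiv ℝ u y (e i)) := fun i =>
    (hu.fderiv_right (m := 1) (by norm_num)).clm_apply contDiff_const
  have hg : ContDiff ℝ 1 (fun y => u y * η y ^ 2) := hu1.mul (hη.pow 2)
  have hgc : HasCompactSupport (fun y => u y * η y ^ 2) := by
    have : HasCompactSupport (fun y => η y * (η y * u y)) := hc.mul_right
    exact hcs_congr this fun y => by ring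
  have hgd : Differentiable ℝ (fun y => u y * η y ^ 2) := hg.differentiable (by norm_num)
  have cg : ∀ i, Continuous (fun x => fderiv ℝ (fun y => u y * η y ^ 2) x (e i)) := fun i =>
    (hg.continuous_fderiv (by norm_num)).clm_apply continuous_const
  have cD : ∀ i, Continuous (fun x => fderiv ℝ (fun y => fderiv ℝ u y (e i)) x (e i)) := fun i =>
    ((hD i).continuous_fderiv (by norm_num)).clm_apply continuous_const
  have sg : ∀ i, HasCompactSupport (fun x => fderiv ℝ (fun y => u y * η y ^ 2) x (e i)) :=
    fun i => hgc.fderiv_apply (𝕜 := ℝ) (e i)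
  have I1 : ∀ i, Integrable (fun x => fderiv ℝ u x (e i)
      * fderiv ℝ (fun y => u y * η y ^ 2) x (e i)) := fun i =>
    ((hD i).continuous.mul (cg i)).integrable_of_hasCompactSupport (sg i).mul_left
  have I2 : ∀ i, Integrable (fun x => fderiv ℝ (fun y => fderiv ℝ u y (e i)) x (e i)
      * (u x * η x ^ 2)) := fun i =>
    ((cD i).mul hg.continuous).integrable_of_hasCompactSupport hgc.mul_left
  have I3 : ∀ i, Integrable (fun x => fderiv ℝ u x (e i) * (u x * η x ^ 2)) := fun i =>
    ((hD i).continuous.mul hg.continuous).integrable_of_hasCompactSupport hgc.mul_left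
  have I4 : Integrable (fun x => u x ^ 2 * ‖fderiv ℝ η x‖ ^ 2) := by
    refine Continuous.integrable_of_hasCompactSupport ?_ ?_
    · exact (hu1.continuous.pow 2).mul ((hη.continuous_fderiv (by norm_num)).norm.pow 2)
    · have : HasCompactSupport (fun x => ‖fderiv ℝ η x‖ * (‖fderiv ℝ η x‖ * u x ^ 2)) :=
        (hc.fderiv (𝕜 := ℝ)).norm.mul_right
      exact hcs_congr this fun y => by ring
  have ibp : ∀ i, ∫ x, fderiv ℝ u x (e i) * fderiv ℝ (fun y => u y * η y ^ 2) x (e i)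
      = - ∫ x, fderiv ℝ (fun y => fderiv ℝ u y (e i)) x (e i) * (u x * η x ^ 2) := fun i =>
    integral_mul_fderiv_eq_neg_fderiv_mul_of_integrable (I2 i) (I1 i) (I3 i)
      (fun x _ => (hD i).differentiable (by norm_num) x) (fun x _ => hgd x)
  have pt : ∀ x, ‖fderiv ℝ (fun y => u y * η y) x‖ ^ 2
      = (∑ i, fderiv ℝ u x (e i) * fderiv ℝ (fun y => u y * η y ^ 2) x (e i))
        + u x ^ 2 * ‖fderiv ℝ η x‖ ^ 2 := by
    intro x
    rw [norm_fderiv_sq, norm_fderiv_sq, Finset.mul_sum, ← Finset.sum_add_distrib]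
    refine Finset.sum_congr rfl fun i _ => ?_
    have d1 : fderiv ℝ (fun y => u y * η y) x = _ :=
      ((hud x).hasFDerivAt.mul (hηd x).hasFDerivAt).fderiv
    have d2 : fderiv ℝ (fun y => u y * η y ^ 2) x = _ :=
      ((hud x).hasFDerivAt.mul ((hηd x).hasFDerivAt.pow 2)).fderiv
    rw [d1, d2]
    simp [e]
    ring
  have l : ∀ x, (-lap u x) * (u x * η x ^ 2)
      = ∑ i, - (fderiv ℝ (fun y => fderiv ℝ u y (e i)) x (e i) * (u x * η x ^ 2)) := by
    intro x
    simp only [lap, e]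
    rw [Finset.sum_neg_distrib, ← Finset.sum_mul]; ring
  simp_rw [pt, l]
  rw [integral_add (integrable_finsetSum _ fun i _ => I1 i) I4,
    integral_finsetSum _ fun i _ => I1 i, integral_finsetSum _ fun i _ => (I2 i).fun_neg]
  simp_rw [ibp, integral_neg]

/-- Volume bound: this is where subcriticality is used. -/
lemma vol_bound {N : ℕ} (a p ε M c : ℝ) (hp : 1 < p) (hε : 0 < ε) (hc : 0 ≤ c)
    (hN : (N : ℝ) ≤ (2 + a) * (2 / (p - 1)) + 2) (R : ℝ) (hR : 1 ≤ R) :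
    (c * (M / R) ^ 2 / (ε * R ^ a)) ^ (2 / (p - 1)) * (c * (M / R) ^ 2)
      * volume.real (closedBall (0 : EuclideanSpace ℝ (Fin N)) (2 * R))
    ≤ (c * M ^ 2 / ε) ^ (2 / (p - 1)) * (c * M ^ 2) * 2 ^ N
      * volume.real (closedBall (0 : EuclideanSpace ℝ (Fin N)) 1) := by
  have hR0 : 0 < R := by linarith
  set q := 2 / (p - 1)
  rw [Measure.addHaar_real_closedBall' _ _ (by positivity : (0 : ℝ) ≤ 2 * R)]
  have hfr : Module.finrank ℝ (EuclideanSpace ℝ (Fin N)) = N := by simp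
  rw [hfr]
  have e1 : c * (M / R) ^ 2 / (ε * R ^ a) = (c * M ^ 2 / ε) * R ^ (-(2 + a)) := by
    rw [Real.rpow_neg hR0.le, Real.rpow_add hR0, Real.rpow_two]
    field_simp
  have e2 : (c * (M / R) ^ 2) = c * M ^ 2 * R ^ (-(2 : ℝ)) := by
    rw [Real.rpow_neg hR0.le, Real.rpow_two]
    field_simp
  rw [e1, e2, Real.mul_rpow (by positivity) (by positivity), ← Real.rpow_mul hR0.le, mul_pow]
  have e3 : R ^ (-(2 + a) * q) * R ^ (-(2 : ℝ)) * R ^ N ≤ 1 := by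
    rw [← Real.rpow_natCast R N, ← Real.rpow_add hR0, ← Real.rpow_add hR0]
    exact Real.rpow_le_one_of_one_le_of_nonpos hR (by linarith)
  calc _ = ((c * M ^ 2 / ε) ^ q * (c * M ^ 2) * 2 ^ N
      * volume.real (closedBall (0 : EuclideanSpace ℝ (Fin N)) 1)) *
        (R ^ (-(2 + a) * q) * R ^ (-(2 : ℝ)) * R ^ N) := by ring
    _ ≤ ((c * M ^ 2 / ε) ^ q * (c * M ^ 2) * 2 ^ N
      * volume.real (closedBall (0 : EuclideanSpace ℝ (Fin N)) 1)) * 1 := by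
        gcongr
    _ = _ := by ring

/-- Integrability of a nonnegative continuous function from bounds with cutoffs. -/
lemma integrable_of_tail {N : ℕ} (h : EuclideanSpace ℝ (Fin N) → ℝ) (hc : Continuous h)
    (h0 : ∀ x, 0 ≤ h x) (R1 C : ℝ) (G : ℝ → EuclideanSpace ℝ (Fin N) → ℝ)
    (hGi : ∀ R, R1 < R → Integrable (G R)) (hG0 : ∀ R x, R1 < R → 0 ≤ G R x)
    (hG : ∀ R x, R1 < R → R1 < ‖x‖ → ‖x‖ < R → G R x = h x)
    (hGC : ∀ R, R1 < R → ∫ x, G R x ≤ C) : Integrable h := by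
  have hloc : ∀ R : ℝ, IntegrableOn h (ball 0 R) := fun R =>
    (hc.continuousOn.integrableOn_compact (isCompact_closedBall 0 R)).mono_set
      ball_subset_closedBall
  have hlocc : IntegrableOn h (closedBall 0 R1) :=
    hc.continuousOn.integrableOn_compact (isCompact_closedBall 0 R1)
  refine (aecover_ball (μ := volume) (x := (0 : EuclideanSpace ℝ (Fin N)))
    (r := fun R : ℝ => R) (l := Filter.atTop) Filter.tendsto_id).integrable_of_integral_bounded_of_nonneg_ae
    ((∫ x in closedBall 0 R1, h x) + C) (fun R => hloc R) (Filter.Eventually.of_forall h0) ?_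
  filter_upwards [Filter.eventually_gt_atTop R1] with R hR
  rw [← integral_indicator measurableSet_ball, ← integral_indicator measurableSet_closedBall]
  refine le_trans ?_ (add_le_add le_rfl (hGC R hR))
  have i1 := hlocc.integrable_indicator measurableSet_closedBall
  rw [← integral_add i1 (hGi R hR)]
  refine integral_mono ((hloc R).integrable_indicator measurableSet_ball) (i1.add (hGi R hR)) ?_
  intro x
  have g0 := hG0 R x hR
  have h0x := h0 x
  by_cases hx : ‖x‖ ≤ R1
  · have : x ∈ closedBall (0 : EuclideanSpace ℝ (Fin N)) R1 := by simpa using hx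
    simp only [Pi.add_apply, Set.indicator_of_mem this]
    refine (Set.indicator_le_self' (f := h) (fun y _ => h0 y) x).trans ?_
    linarith
  · push Not at hx
    have n : x ∉ closedBall (0 : EuclideanSpace ℝ (Fin N)) R1 := by simpa using hx
    simp only [Set.indicator_of_notMem n, zero_add]
    by_cases hx2 : ‖x‖ < R
    · rw [hG R x hR hx hx2]
      exact Set.indicator_le_self' (f := h) (fun y _ => h0 y) x
    · have n2 : x ∉ ball (0 : EuclideanSpace ℝ (Fin N)) R := by simpa using hx2
      rw [Set.indicator_of_notMem n2]; exact g0

/-- **Finiteness of the energy for solutions of the Hénon equation stable outside a compact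
set.** Let `a ≥ 0`, `N ≥ 3`, `1 < p < (N+2+2a)/(N-2)`, and let `u` be a positive `C²`
solution of `-Δu = |x|^a u^p` on `ℝ^N` which is stable outside a compact set `Σ`.
Then `∇u ∈ L²(ℝ^N)` and `|x|^a u^(p+1) ∈ L¹(ℝ^N)`. -/
theorem henon_stable_outside_compact_energy_finite
    (N : ℕ) (hN : 3 ≤ N) (a p : ℝ) (ha : 0 ≤ a) (hp : 1 < p)
    (hsub : p < ((N : ℝ) + 2 + 2 * a) / ((N : ℝ) - 2))
    (u : EuclideanSpace ℝ (Fin N) → ℝ)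
    (hu : ContDiff ℝ 2 u) (hupos : ∀ x, 0 < u x)
    (hequ : ∀ x, -lap u x = ‖x‖ ^ a * u x ^ p)
    (K : Set (EuclideanSpace ℝ (Fin N))) (hK : IsCompact K)
    (hstable : ∀ φ : EuclideanSpace ℝ (Fin N) → ℝ,
      ContDiff ℝ 1 φ → HasCompactSupport φ → Disjoint (tsupport φ) K →
      0 ≤ (∫ x, ‖gradient φ x‖ ^ 2) - p * ∫ x, ‖x‖ ^ a * u x ^ (p - 1) * φ x ^ 2) :
    Integrable (fun x => ‖gradient u x‖ ^ 2) (volume : Measure (EuclideanSpace ℝ (Fin N))) ∧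
    Integrable (fun x => ‖x‖ ^ a * u x ^ (p + 1))
      (volume : Measure (EuclideanSpace ℝ (Fin N))) := by
  have hu1 : ContDiff ℝ 1 u := hu.of_le (by norm_num)
  have huc : Continuous u := hu.continuous
  have hp1 : 0 < p - 1 := by linarith
  set f : EuclideanSpace ℝ (Fin N) → ℝ := fun x => ‖x‖ ^ a * u x ^ (p + 1) with hf
  have hfc : Continuous f :=
    (continuous_norm.rpow_const fun _ => Or.inr ha).mul
      (huc.rpow_const fun x => Or.inl (hupos x).ne')
  have hf0 : ∀ x, 0 ≤ f x := fun x =>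
    mul_nonneg (Real.rpow_nonneg (norm_nonneg x) a) (Real.rpow_nonneg (hupos x).le _)
  have hupow : ∀ x, u x ^ p * u x = u x ^ (p + 1) := fun x => by
    rw [Real.rpow_add (hupos x), Real.rpow_one]
  have hupow2 : ∀ x, u x ^ (p - 1) * u x ^ 2 = u x ^ (p + 1) := fun x => by
    rw [← Real.rpow_natCast (u x) 2, ← Real.rpow_add (hupos x)]; congr 1; push_cast; ring
  -- energy identity and the stability inequality for `u * η`
  have hen : ∀ η : EuclideanSpace ℝ (Fin N) → ℝ, ContDiff ℝ 1 η → HasCompactSupport η →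
      ∫ x, ‖fderiv ℝ (fun y => u y * η y) x‖ ^ 2
        = (∫ x, f x * η x ^ 2) + ∫ x, u x ^ 2 * ‖fderiv ℝ η x‖ ^ 2 := by
    intro η h1 h2
    rw [energy u η hu h1 h2]
    congr 1
    refine integral_congr_ae (Filter.Eventually.of_forall fun x => ?_)
    simp only [hequ, hf, ← hupow]; ring
  have hst : ∀ η : EuclideanSpace ℝ (Fin N) → ℝ, ContDiff ℝ 1 η → HasCompactSupport η →
      Disjoint (tsupport η) K →
      (p - 1) * ∫ x, f x * η x ^ 2 ≤ ∫ x, u x ^ 2 * ‖fderiv ℝ η x‖ ^ 2 := by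
    intro η h1 h2 h3
    have hts : tsupport (fun y => u y * η y) ⊆ tsupport η :=
      closure_mono (Function.support_mul_subset_right u η)
    have := hstable (fun y => u y * η y) (hu1.mul h1) h2.mul_left (h3.mono_left hts)
    simp only [norm_gradient_eq] at this
    rw [hen η h1 h2] at this
    have e : ∫ x, ‖x‖ ^ a * u x ^ (p - 1) * (u x * η x) ^ 2 = ∫ x, f x * η x ^ 2 := by
      refine integral_congr_ae (Filter.Eventually.of_forall fun x => ?_)
      simp only [hf, ← hupow2]; ring
    rw [e] at this
    linarith
  -- choice of the cutoffs
  obtain ⟨R0, hR0, hKR⟩ : ∃ R0 : ℝ, 0 < R0 ∧ K ⊆ ball 0 R0 := by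
    obtain ⟨r, hr⟩ := hK.isBounded.subset_ball (0 : EuclideanSpace ℝ (Fin N))
    exact ⟨max r 1, by positivity, hr.trans (ball_subset_ball (le_max_left _ _))⟩
  let b0 : ContDiffBump (0 : EuclideanSpace ℝ (Fin N)) := ⟨R0, R0 + 1, hR0, by linarith⟩
  let b : ContDiffBump (0 : EuclideanSpace ℝ (Fin N)) := ⟨1, 2, one_pos, by norm_num⟩
  let χ : EuclideanSpace ℝ (Fin N) → ℝ := fun x => 1 - b0 x
  have hχ : ContDiff ℝ 1 χ := contDiff_const.sub b0.contDiff
  have hχ1 : ∀ x, R0 + 1 < ‖x‖ → χ =ᶠ[nhds x] fun _ => 1 := by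
    intro x hx
    filter_upwards [continuous_norm.isOpen_preimage _ isOpen_Ioi |>.mem_nhds hx] with y hy
    have : b0 y = 0 := b0.zero_of_le_dist (by simpa [b0] using le_of_lt hy)
    simp [χ, this]
  have hχfc : HasCompactSupport (fderiv ℝ χ) := by
    have : fderiv ℝ χ = fun x => - fderiv ℝ b0 x := by
      funext x; exact fderiv_const_sub 1
    rw [this]
    exact (b0.hasCompactSupport.fderiv (𝕜 := ℝ)).neg
  obtain ⟨m, hm⟩ := exists_nat_ge (2 / (p - 1))
  obtain ⟨M, hM⟩ : ∃ M, ∀ x, ‖fderiv ℝ b x‖ ≤ M :=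
    (b.hasCompactSupport.fderiv (𝕜 := ℝ)).exists_bound_of_continuous
      (b.contDiff.continuous_fderiv (n := 1) (by norm_num))
  have hM0 : 0 ≤ M := (norm_nonneg _).trans (hM 0)
  let θ : ℝ → EuclideanSpace ℝ (Fin N) → ℝ := fun R x => b (R⁻¹ • x)
  let η : ℝ → EuclideanSpace ℝ (Fin N) → ℝ := fun R x => χ x * θ R x ^ (m + 1)
  have hθ : ∀ R, ContDiff ℝ 1 (θ R) := fun R => b.contDiff.comp (contDiff_const_smul _)
  have hη : ∀ R, ContDiff ℝ 1 (η R) := fun R => hχ.mul ((hθ R).pow _)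
  have hθ1 : ∀ R x, 0 < R → ‖x‖ < R → θ R =ᶠ[nhds x] fun _ => 1 := by
    intro R x hR hx
    filter_upwards [continuous_norm.isOpen_preimage _ isOpen_Iio |>.mem_nhds hx] with y hy
    refine b.one_of_mem_closedBall ?_
    have hy : ‖y‖ < R := hy
    simp only [b, mem_closedBall_zero_iff, norm_smul, norm_inv, Real.norm_of_nonneg hR.le]
    rw [inv_mul_le_iff₀ hR]; linarith
  have hθ0 : ∀ R x, 0 < R → 2 * R < ‖x‖ → θ R x = 0 := by
    intro R x hR hx
    refine b.zero_of_le_dist ?_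
    simp only [b, dist_zero_right, norm_smul, norm_inv, Real.norm_of_nonneg hR.le]
    rw [le_inv_mul_iff₀ hR]; linarith
  have hηcs : ∀ R, 0 < R → HasCompactSupport (η R) := fun R hR =>
    HasCompactSupport.intro (isCompact_closedBall 0 (2 * R)) fun x hx => by
      simp only [mem_closedBall_zero_iff, not_le] at hx
      simp [η, hθ0 R x hR hx]
  have hηK : ∀ R, Disjoint (tsupport (η R)) K := by
    intro R
    rw [Set.disjoint_right]
    intro x hx
    rw [notMem_tsupport_iff_eventuallyEq]
    filter_upwards [isOpen_ball.mem_nhds (hKR hx)] with y hy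
    have : b0 y = 1 := b0.one_of_mem_closedBall (ball_subset_closedBall hy)
    simp [η, χ, this]
  have hη1 : ∀ R x, 0 < R → R0 + 1 < ‖x‖ → ‖x‖ < R → η R =ᶠ[nhds x] fun _ => 1 := by
    intro R x hR h1 h2
    filter_upwards [hχ1 x h1, hθ1 R x hR h2] with y h3 h4
    simp [η, h3, h4]
  have hdθ : ∀ R x, 0 < R → ‖fderiv ℝ (θ R) x‖ ≤ M / R := by
    intro R x hR
    have h1 : HasFDerivAt (θ R) ((fderiv ℝ b (R⁻¹ • x)).comp
        (R⁻¹ • ContinuousLinearMap.id ℝ (EuclideanSpace ℝ (Fin N)))) x := by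
      have hb : HasFDerivAt b (fderiv ℝ b (R⁻¹ • x)) (R⁻¹ • x) :=
        ((b.contDiff (n := 1)).differentiable (by norm_num) _).hasFDerivAt
      exact hb.comp x ((hasFDerivAt_id x).const_smul R⁻¹)
    rw [h1.fderiv, ContinuousLinearMap.comp_smul, ContinuousLinearMap.comp_id, norm_smul,
      norm_inv, Real.norm_of_nonneg hR.le, div_eq_inv_mul]
    exact mul_le_mul_of_nonneg_left (hM _) (by positivity)
  -- pointwise estimate
  set ε : ℝ := (p - 1) / 2 with hε
  have hε0 : 0 < ε := by positivity
  set c : ℝ := ((m : ℝ) + 1) ^ 2 with hcdef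
  have hc0 : 0 ≤ c := by positivity
  let B : ℝ → ℝ := fun R =>
    (c * (M / R) ^ 2 / (ε * R ^ a)) ^ (2 / (p - 1)) * (c * (M / R) ^ 2)
  have hB0 : ∀ R, 0 < R → 0 ≤ B R := fun R hR => by positivity
  have hpt : ∀ R x, R0 + 1 < R → u x ^ 2 * ‖fderiv ℝ (η R) x‖ ^ 2 ≤
      u x ^ 2 * ‖fderiv ℝ χ x‖ ^ 2 + ε * (f x * η R x ^ 2)
        + (closedBall 0 (2 * R)).indicator (fun _ => B R) x := by
    intro R x hR
    have hRpos : 0 < R := by linarith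
    have n1 : 0 ≤ u x ^ 2 * ‖fderiv ℝ χ x‖ ^ 2 := by positivity
    have n2 : 0 ≤ ε * (f x * η R x ^ 2) :=
      mul_nonneg hε0.le (mul_nonneg (hf0 x) (sq_nonneg _))
    have n3 : 0 ≤ (closedBall (0 : EuclideanSpace ℝ (Fin N)) (2 * R)).indicator
        (fun _ => B R) x := Set.indicator_nonneg (fun _ _ => hB0 R hRpos) x
    by_cases hx : ‖x‖ < R
    · have : η R =ᶠ[nhds x] χ := by
        filter_upwards [hθ1 R x hRpos hx] with y hy
        simp [η, hy]
      rw [this.fderiv_eq]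
      linarith
    · push Not at hx
      have hxpos : 0 < ‖x‖ := by linarith
      have hχx := hχ1 x (by linarith)
      have he : η R =ᶠ[nhds x] fun y => θ R y ^ (m + 1) := by
        filter_upwards [hχx] with y hy
        simp [η, hy]
      have hd : fderiv ℝ (fun y => θ R y ^ (m + 1)) x
          = (((m : ℝ) + 1) * θ R x ^ m) • fderiv ℝ (θ R) x := by
        have := (((hθ R).differentiable (by norm_num) x).hasFDerivAt.pow (m + 1)).fderiv
        refine Eq.trans this ?_
        simp
      have hs : ‖fderiv ℝ (η R) x‖ ^ 2
          = (((m : ℝ) + 1) * θ R x ^ m) ^ 2 * ‖fderiv ℝ (θ R) x‖ ^ 2 := by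
        rw [he.fderiv_eq, hd, norm_smul, mul_pow, Real.norm_eq_abs, sq_abs]
      by_cases hx2 : ‖x‖ ≤ 2 * R
      · have hmem : x ∈ closedBall (0 : EuclideanSpace ℝ (Fin N)) (2 * R) := by simpa using hx2
        have hy := young_pt p (‖x‖ ^ a) (u x) (θ R x) (‖fderiv ℝ (θ R) x‖ ^ 2) ε m hp
          (Real.rpow_pos_of_pos hxpos a) (hupos x) b.nonneg b.le_one (sq_nonneg _) hε0 hm
        rw [Set.indicator_of_mem hmem, hs, he.eq_of_nhds]
        have hb : (c * ‖fderiv ℝ (θ R) x‖ ^ 2 / (ε * ‖x‖ ^ a)) ^ (2 / (p - 1))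
            * (c * ‖fderiv ℝ (θ R) x‖ ^ 2) ≤ B R := by
          have hd1 := hdθ R x hRpos
          simp only [B]
          gcongr
        rw [← mul_assoc]
        simp only [hf]
        linarith
      · push Not at hx2
        have hm0 : m ≠ 0 := by
          rintro rfl
          have : 0 < 2 / (p - 1) := by positivity
          simp at hm; linarith
        rw [hs, hθ0 R x hRpos hx2, zero_pow hm0]
        simp only [mul_zero, zero_pow two_ne_zero, zero_mul]
        linarith
  -- integrated estimate
  have hiχ : Integrable (fun x => u x ^ 2 * ‖fderiv ℝ χ x‖ ^ 2) := by
    refine Continuous.integrable_of_hasCompactSupport ?_ ?_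
    · exact (huc.pow 2).mul ((hχ.continuous_fderiv (by norm_num)).norm.pow 2)
    · have : HasCompactSupport (fun x => ‖fderiv ℝ χ x‖ * (‖fderiv ℝ χ x‖ * u x ^ 2)) :=
        hχfc.norm.mul_right
      exact hcs_congr this fun y => by ring
  have hifη : ∀ R, 0 < R → Integrable (fun x => f x * η R x ^ 2) := by
    intro R hR
    refine Continuous.integrable_of_hasCompactSupport
      (hfc.mul ((hη R).continuous.pow 2)) ?_
    have : HasCompactSupport (fun x => η R x * (η R x * f x)) := (hηcs R hR).mul_right
    exact hcs_congr this fun y => by ring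
  have hiη : ∀ R, 0 < R → Integrable (fun x => u x ^ 2 * ‖fderiv ℝ (η R) x‖ ^ 2) := by
    intro R hR
    refine Continuous.integrable_of_hasCompactSupport ?_ ?_
    · exact (huc.pow 2).mul (((hη R).continuous_fderiv (by norm_num)).norm.pow 2)
    · have : HasCompactSupport
          (fun x => ‖fderiv ℝ (η R) x‖ * (‖fderiv ℝ (η R) x‖ * u x ^ 2)) :=
        ((hηcs R hR).fderiv (𝕜 := ℝ)).norm.mul_right
      exact hcs_congr this fun y => by ring
  have hNexp : (N : ℝ) ≤ (2 + a) * (2 / (p - 1)) + 2 := by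
    have h3 : (3 : ℝ) ≤ N := by exact_mod_cast hN
    rw [lt_div_iff₀ (by linarith)] at hsub
    have : (N : ℝ) - 2 ≤ (2 + a) * 2 / (p - 1) := by
      rw [le_div_iff₀ hp1]; nlinarith
    rw [mul_div_assoc] at this
    linarith
  set V : ℝ := (c * M ^ 2 / ε) ^ (2 / (p - 1)) * (c * M ^ 2) * 2 ^ N
      * volume.real (closedBall (0 : EuclideanSpace ℝ (Fin N)) 1) with hV
  set D : ℝ := ∫ x, u x ^ 2 * ‖fderiv ℝ χ x‖ ^ 2 with hD
  have hint : ∀ R, R0 + 1 < R → ∫ x, u x ^ 2 * ‖fderiv ℝ (η R) x‖ ^ 2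
      ≤ D + ε * (∫ x, f x * η R x ^ 2) + V := by
    intro R hR
    have hRpos : 0 < R := by linarith
    have i3 : Integrable ((closedBall (0 : EuclideanSpace ℝ (Fin N)) (2 * R)).indicator
        (fun _ => B R)) := by
      refine IntegrableOn.integrable_indicator ?_ measurableSet_closedBall
      exact continuousOn_const.integrableOn_compact (isCompact_closedBall _ _)
    have i2 := (hifη R hRpos).const_mul ε
    have h := integral_mono (hiη R hRpos) ((hiχ.add i2).add i3) (fun x => hpt R x hR)
    rw [integral_add' (hiχ.add i2) i3, integral_add' hiχ i2, integral_const_mul,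
      integral_indicator measurableSet_closedBall, setIntegral_const, smul_eq_mul] at h
    have hv := vol_bound (N := N) a p ε M c hp hε0 hc0 hNexp R (by linarith)
    have hv' : volume.real (closedBall (0 : EuclideanSpace ℝ (Fin N)) (2 * R)) * B R ≤ V := by
      rw [mul_comm]; exact hv
    linarith
  have hmain : ∀ R, R0 + 1 < R → ∫ x, f x * η R x ^ 2 ≤ (D + V) / ε := by
    intro R hR
    have h1 := hst (η R) (hη R) (hηcs R (by linarith)) (hηK R)
    have h2 := hint R hR
    rw [le_div_iff₀ hε0]
    have : p - 1 = 2 * ε := by rw [hε]; ring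
    rw [this] at h1
    linarith
  have hmain2 : ∀ R, R0 + 1 < R → ∫ x, ‖fderiv ℝ (fun y => u y * η R y) x‖ ^ 2
      ≤ (D + V) / ε + (D + (D + V) + V) := by
    intro R hR
    rw [hen (η R) (hη R) (hηcs R (by linarith))]
    have h1 := hmain R hR
    have h2 := hint R hR
    have h3 := mul_le_mul_of_nonneg_left h1 hε0.le
    rw [mul_div_cancel₀ _ hε0.ne'] at h3
    linarith
  constructor
  · simp only [norm_gradient_eq]
    refine integrable_of_tail _ ((hu1.continuous_fderiv (by norm_num)).norm.pow 2)
      (fun x => sq_nonneg _) (R0 + 1) _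
      (fun R x => ‖fderiv ℝ (fun y => u y * η R y) x‖ ^ 2) ?_ (fun R x _ => sq_nonneg _) ?_ hmain2
    · intro R hR
      have hRpos : 0 < R := by linarith
      refine Continuous.integrable_of_hasCompactSupport
        (((hu1.mul (hη R)).continuous_fderiv (by norm_num)).norm.pow 2) ?_
      have h1 : HasCompactSupport (fun y => u y * η R y) := (hηcs R hRpos).mul_left
      have : HasCompactSupport (fun x => ‖fderiv ℝ (fun y => u y * η R y) x‖
          * ‖fderiv ℝ (fun y => u y * η R y) x‖) := (h1.fderiv (𝕜 := ℝ)).norm.mul_right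
      exact hcs_congr this fun y => by ring
    · intro R x hR h1 h2
      have : (fun y => u y * η R y) =ᶠ[nhds x] u := by
        filter_upwards [hη1 R x (by linarith) h1 h2] with y hy
        simp [hy]
      simp only [this.fderiv_eq]
  · refine integrable_of_tail f hfc hf0 (R0 + 1) _ (fun R x => f x * η R x ^ 2)
      (fun R hR => hifη R (by linarith)) (fun R x _ => mul_nonneg (hf0 x) (sq_nonneg _)) ?_ hmain
    intro R x hR h1 h2
    simp [(hη1 R x (by linarith) h1 h2).eq_of_nhds]
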